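/- Let X be a separable real Banach space. If there exists a > 0 such that RW(a, X) = a, then RW(b, X) = b for all b ≥ a. -/

import Mathlib

open Filter Topology

/-- The coefficient `RW(a, X)` of García-Falset, Llorens-Fuster and Mazcuñán-Navarro. -/
noncomputable def RWCoeff (X : Type*) [NormedAddCommGroup X] [NormedSpace ℝ X] (a : ℝ) : ℝ :=
  sSup {r : ℝ | ∃ (x : X) (xs : ℕ → X), ‖x‖ ≤ a ∧ (∀ n, ‖xs n‖ ≤ 1) ∧
    (∀ f : X →L[ℝ] ℝ, Filter.Tendsto (fun n => f (xs n)) Filter.atTop (nhds 0)) ∧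
    r = min (Filter.liminf (fun n => ‖xs n + x‖) Filter.atTop)
            (Filter.liminf (fun n => ‖xs n - x‖) Filter.atTop)}

theorem liminf_norm_add_le_add {X : Type*} [NormedAddCommGroup X] {xs : ℕ → X}
    (hxs : ∀ n, ‖xs n‖ ≤ 1) {x y : X} {c d : ℝ}
    (hc : liminf (fun n => ‖xs n + y‖) atTop ≤ c) (hd : ‖x - y‖ ≤ d) :
    liminf (fun n => ‖xs n + x‖) atTop ≤ c + d := by
  refine le_of_forall_pos_le_add fun ε hε => ?_
  have hbdd : ∀ z : X, IsBoundedUnder (· ≤ ·) atTop (fun n => ‖xs n + z‖) := fun z =>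
    isBoundedUnder_of ⟨1 + ‖z‖, fun n => (norm_add_le _ _).trans (by linarith [hxs n])⟩
  have hfreq : ∃ᶠ n in atTop, ‖xs n + y‖ < c + ε :=
    frequently_lt_of_liminf_lt (hbdd y).isCoboundedUnder_ge (by linarith)
  refine liminf_le_of_frequently_le (hfreq.mono fun n hn => ?_)
    (isBoundedUnder_of ⟨0, fun n => norm_nonneg _⟩)
  calc ‖xs n + x‖ = ‖(xs n + y) + (x - y)‖ := by congr 1; abel
    _ ≤ ‖xs n + y‖ + ‖x - y‖ := norm_add_le _ _
    _ ≤ c + d + ε := by linarith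

theorem liminf_norm_add_le {X : Type*} [NormedAddCommGroup X] {xs : ℕ → X}
    (hxs : ∀ n, ‖xs n‖ ≤ 1) {x : X} {a : ℝ} (hx : ‖x‖ ≤ a) :
    liminf (fun n => ‖xs n + x‖) atTop ≤ 1 + a :=
  liminf_le_of_frequently_le
    (Frequently.of_forall fun n => (norm_add_le _ _).trans (add_le_add (hxs n) hx))
    (isBoundedUnder_of ⟨0, fun _ => norm_nonneg _⟩)

theorem min_liminf_le_RWCoeff {X : Type*} [NormedAddCommGroup X] [NormedSpace ℝ X] {a : ℝ}
    {x : X} {xs : ℕ → X} (hx : ‖x‖ ≤ a) (hxs : ∀ n, ‖xs n‖ ≤ 1)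
    (hw : ∀ f : X →L[ℝ] ℝ, Tendsto (fun n => f (xs n)) atTop (𝓝 0)) :
    min (liminf (fun n => ‖xs n + x‖) atTop) (liminf (fun n => ‖xs n - x‖) atTop)
      ≤ RWCoeff X a := by
  refine le_csSup ⟨1 + a, ?_⟩ ⟨x, xs, hx, hxs, hw, rfl⟩
  rintro r ⟨y, ys, hy, hys, -, rfl⟩
  exact (min_le_left _ _).trans (liminf_norm_add_le hys hy)

theorem RWCoeff_eq_zero_of_subsingleton (X : Type*) [NormedAddCommGroup X] [NormedSpace ℝ X]
    [Subsingleton X] (a : ℝ) : RWCoeff X a = 0 := by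
  have hsub : ∀ r ∈ {r : ℝ | ∃ (x : X) (xs : ℕ → X), ‖x‖ ≤ a ∧ (∀ n, ‖xs n‖ ≤ 1) ∧
      (∀ f : X →L[ℝ] ℝ, Tendsto (fun n => f (xs n)) atTop (𝓝 0)) ∧
      r = min (liminf (fun n => ‖xs n + x‖) atTop) (liminf (fun n => ‖xs n - x‖) atTop)},
      r = 0 := by
    rintro r ⟨x, xs, -, -, -, rfl⟩
    simp [norm_of_subsingleton]
  exact le_antisymm (Real.sSup_nonpos fun r hr => (hsub r hr).le)
    (Real.sSup_nonneg fun r hr => (hsub r hr).ge)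

theorem stmt7 (X : Type*) [NormedAddCommGroup X] [NormedSpace ℝ X] [CompleteSpace X]
    [TopologicalSpace.SeparableSpace X] (a : ℝ) (ha : 0 < a) (hRWa : RWCoeff X a = a) :
    ∀ b : ℝ, a ≤ b → RWCoeff X b = b := by
  intro b hab
  have hb : 0 < b := ha.trans_le hab
  rcases subsingleton_or_nontrivial X with hX | hX
  · rw [RWCoeff_eq_zero_of_subsingleton] at hRWa
    exact absurd hRWa ha.ne
  refine le_antisymm (Real.sSup_le ?_ hb.le) ?_
  · rintro r ⟨x, xs, hx, hxs, hw, rfl⟩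
    set y : X := (a / b) • x with hy
    have hya : ‖y‖ ≤ a := by
      rw [hy, norm_smul, Real.norm_of_nonneg (by positivity)]
      calc a / b * ‖x‖ ≤ a / b * b := by gcongr
        _ = a := by field_simp
    have hxy : ‖x - y‖ ≤ b - a := by
      have h : x - y = (1 - a / b) • x := by rw [hy, sub_smul, one_smul]
      have h1 : 0 ≤ 1 - a / b := sub_nonneg.2 ((div_le_one hb).2 hab)
      rw [h, norm_smul, Real.norm_of_nonneg h1]
      calc (1 - a / b) * ‖x‖ ≤ (1 - a / b) * b := by gcongr
        _ = b - a := by field_simp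
    have key := (min_liminf_le_RWCoeff hya hxs hw).trans_eq hRWa
    rcases min_le_iff.1 key with h | h
    · exact (min_le_left _ _).trans
        ((liminf_norm_add_le_add hxs h hxy).trans_eq (by ring))
    · have hxy' : ‖-x - -y‖ ≤ b - a := by rwa [← neg_sub', norm_neg]
      simp only [sub_eq_add_neg (xs _)] at h ⊢
      exact (min_le_right _ _).trans
        ((liminf_norm_add_le_add hxs h hxy').trans_eq (by ring))
  · obtain ⟨x, hx⟩ := NormedSpace.exists_lt_norm ℝ X 0
    have hxb : ‖(b / ‖x‖) • x‖ = b := by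
      rw [norm_smul, Real.norm_of_nonneg (by positivity), div_mul_cancel₀ _ hx.ne']
    simpa only [zero_add, zero_sub, norm_neg, hxb, liminf_const, min_self] using
      min_liminf_le_RWCoeff (xs := fun _ => (0 : X)) hxb.le (by simp) (by simp)
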